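/- Let E₁ = {a, b, c}, E₂ = {a, b, d}, E_k = {a, b}, and let L = {ba, cdb, dcb} be a language over E₁ ∪ E₂ = {a, b, c, d}. Then: (i) L is conditionally decomposable with respect to E₁, E₂ and E_k; and (ii) for i ∈ {1, 2}, the natural projection P^{i+k}_k : E_{i+k}* → E_k* is not a P_{i+k}(L)-observer. Hence conditional decomposability does not imply the observer property of the projections P^{i+k}_k. -/

import Mathlib

/- Language-theoretic model of discrete-event systems:
   strings over a finite alphabet (a `Finset` of symbols) are lists,
   natural projections erase letters outside the target alphabet,
   and the parallel composition is the standard synchronous composition. -/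

namespace DES

variable {A : Type} [DecidableEq A]

/-- `star E` is `E*`: the set of finite strings over the alphabet `E`. -/
def star (E : Finset A) : Set (List A) :=
  {w | ∀ a ∈ w, a ∈ E}

/-- The natural projection onto `E₀`: it keeps letters of `E₀` and erases all
other letters. -/
def proj (E₀ : Finset A) (w : List A) : List A :=
  w.filter (· ∈ E₀)

/-- The inverse image `P⁻¹(L) = { s ∈ E* : P(s) ∈ L }` of the natural projection
from `E*` onto `E₀*`. -/
def invProj (E E₀ : Finset A) (L : Set (List A)) : Set (List A) :=
  {s | s ∈ star E ∧ proj E₀ s ∈ L}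

/-- Parallel composition `L₁ ∥ L₂ = P₁⁻¹(L₁) ∩ P₂⁻¹(L₂) ⊆ (E₁ ∪ E₂)*` of
`L₁ ⊆ E₁*` and `L₂ ⊆ E₂*`. -/
def par (E₁ E₂ : Finset A) (L₁ L₂ : Set (List A)) : Set (List A) :=
  invProj (E₁ ∪ E₂) E₁ L₁ ∩ invProj (E₁ ∪ E₂) E₂ L₂

/-- Parallel composition of a finite family `L i ⊆ (E i)*`. -/
def parFam {ι : Type} [Fintype ι] (E : ι → Finset A) (L : ι → Set (List A)) :
    Set (List A) :=
  {w | w ∈ star (Finset.univ.sup E) ∧ ∀ i, proj (E i) w ∈ L i}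

/-- The prefix closure of a language. -/
def pref (L : Set (List A)) : Set (List A) :=
  {w | ∃ u, w ++ u ∈ L}

/-- `K` is conditionally decomposable w.r.t. the alphabets `E i` and `Ek`:
`K = P_{1+k}(K) ∥ ⋯ ∥ P_{n+k}(K)`. -/
def condDecomp {ι : Type} [Fintype ι] (E : ι → Finset A) (Ek : Finset A)
    (K : Set (List A)) : Prop :=
  K = parFam (fun i => E i ∪ Ek) (fun i => proj (E i ∪ Ek) '' K)

/-- Conditional decomposability for two components:
`K = P_{1+k}(K) ∥ P_{2+k}(K)`. -/
def condDecomp2 (E₁ E₂ Ek : Finset A) (K : Set (List A)) : Prop :=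
  K = par (E₁ ∪ Ek) (E₂ ∪ Ek) (proj (E₁ ∪ Ek) '' K) (proj (E₂ ∪ Ek) '' K)

/-- The natural projection from `E'*` onto `E₀*` is an `L`-observer. -/
def observer (E' E₀ : Finset A) (L : Set (List A)) : Prop :=
  ∀ t ∈ proj E₀ '' L, ∀ s ∈ pref L, proj E₀ s <+: t →
    ∃ u ∈ star E', s ++ u ∈ L ∧ proj E₀ (s ++ u) = t

/-- Letter-to-letter renaming map: letters in `Ekeep` are kept, all other
letters are renamed by `g`. -/
def ren (Ekeep : Finset A) (g : A → A) (w : List A) : List A :=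
  w.map (fun a => if a ∈ Ekeep then a else g a)


/-- The four-letter alphabet `{a, b, c, d}` of the concrete example. -/
inductive Sym : Type
  | a | b | c | d
deriving DecidableEq

open Sym in
/-- for `E₁ = {a,b,c}`, `E₂ = {a,b,d}`, `E_k = {a,b}` and
`L = {ba, cdb, dcb}`: (i) `L` is conditionally decomposable w.r.t.
`E₁, E₂, E_k`, and (ii) for `i ∈ {1,2}` the projection
`P^{i+k}_k : E_{i+k}* → E_k*` is not a `P_{i+k}(L)`-observer.  Hence
conditional decomposability does not imply the observer property. -/
theorem stmt17 :
    condDecomp2 ({a, b, c} : Finset Sym) {a, b, d} {a, b}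
        ({[b, a], [c, d, b], [d, c, b]} : Set (List Sym)) ∧
      ¬ observer (({a, b, c} : Finset Sym) ∪ {a, b}) {a, b}
          (proj (({a, b, c} : Finset Sym) ∪ {a, b}) ''
            ({[b, a], [c, d, b], [d, c, b]} : Set (List Sym))) ∧
      ¬ observer (({a, b, d} : Finset Sym) ∪ {a, b}) {a, b}
          (proj (({a, b, d} : Finset Sym) ∪ {a, b}) ''
            ({[b, a], [c, d, b], [d, c, b]} : Set (List Sym))) := by
  refine ⟨?_, ?_, ?_⟩
  · ext w
    simp only [par, invProj, star, Set.mem_inter_iff, Set.mem_ofPred_eq,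
      Set.image_insert_eq, Set.image_singleton, Set.mem_insert_iff, Set.mem_singleton_iff]
    constructor
    · rintro (rfl | rfl | rfl) <;> decide
    · rintro ⟨⟨-, h₁⟩, -, h₂⟩
      rcases w with _ | ⟨x, _ | ⟨y, _ | ⟨z, _ | ⟨t, w⟩⟩⟩⟩
      · simp [proj] at h₁
      · revert h₁ h₂; cases x <;> decide
      · revert h₁ h₂; cases x <;> cases y <;> decide
      · revert h₁ h₂; cases x <;> cases y <;> cases z <;> decide
      · cases x <;> cases y <;> simp [proj] at h₁ h₂ <;>
          cases z <;> simp at h₁ h₂ <;> cases t <;> simp at h₁ h₂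
  · intro h
    obtain ⟨u, -, ⟨v, hv, hvu⟩, hu⟩ := h [b, a] ⟨[b, a], ⟨[b, a], by simp, rfl⟩, rfl⟩ [c]
      ⟨[b], [c, d, b], by simp, rfl⟩ (by decide)
    rw [← hvu] at hu
    rcases hv with rfl | rfl | rfl
    · simp [proj] at hvu
    · exact absurd hu (by decide)
    · exact absurd hu (by decide)
  · intro h
    obtain ⟨u, -, ⟨v, hv, hvu⟩, hu⟩ := h [b, a] ⟨[b, a], ⟨[b, a], by simp, rfl⟩, rfl⟩ [d]
      ⟨[b], [d, c, b], by simp, rfl⟩ (by decide)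
    rw [← hvu] at hu
    rcases hv with rfl | rfl | rfl
    · simp [proj] at hvu
    · exact absurd hu (by decide)
    · exact absurd hu (by decide)

end DES
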